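/- Let f̂_{k_1}, …, f̂_{k_D} be pairwise orthogonal nonzero vectors in ℝ^p, let ŝ_{k_1}, …, ŝ_{k_D} ∈ ℝ^p, let β ∈ ℝ, let J be an invertible p×p real matrix, and define H via the recursion H^0 = −β I, H^d = H^{d−1} + (ŝ_{k_d} − H^{d−1} f̂_{k_d}) f̂_{k_d}ᵀ/(f̂_{k_d}ᵀ f̂_{k_d}), with H = H^D. Set Q = Σ_{d=1}^{D} f̂_{k_d} f̂_{k_d}ᵀ/(f̂_{k_d}ᵀ f̂_{k_d}). Then H − J⁻¹ = (−β I − J⁻¹)(I − Q) + Σ_{d=1}^{D} (ŝ_{k_d} − J⁻¹ f̂_{k_d}) f̂_{k_d}ᵀ / (f̂_{k_d}ᵀ f̂_{k_d}). -/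

import Mathlib

open Matrix

/-- Decomposition of the error `H - J⁻¹` of the multisecant Quasi-Newton matrix built from
pairwise orthogonal nonzero vectors `f̂_{k_1}, …, f̂_{k_D}`:
`H - J⁻¹ = (-β I - J⁻¹)(I - Q) + Σ_d (ŝ_{k_d} - J⁻¹ f̂_{k_d}) f̂_{k_d}ᵀ/(f̂_{k_d}ᵀ f̂_{k_d})`,
where `Q = Σ_d f̂_{k_d} f̂_{k_d}ᵀ/(f̂_{k_d}ᵀ f̂_{k_d})`. -/
theorem anderson_error_decomposition (p D : ℕ)
    (fh sh : ℕ → Fin p → ℝ)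
    (horth : ∀ d ∈ Finset.Icc 1 D, ∀ q ∈ Finset.Icc 1 D, d ≠ q → fh d ⬝ᵥ fh q = 0)
    (hnz : ∀ d ∈ Finset.Icc 1 D, fh d ≠ 0)
    (β : ℝ)
    (J : Matrix (Fin p) (Fin p) ℝ) (hJ : IsUnit J)
    (H : ℕ → Matrix (Fin p) (Fin p) ℝ)
    (hH0 : H 0 = (-β) • (1 : Matrix (Fin p) (Fin p) ℝ))
    (hH : ∀ d, 1 ≤ d → d ≤ D →
      H d = H (d - 1) +
        (fh d ⬝ᵥ fh d)⁻¹ • vecMulVec (sh d - (H (d - 1)).mulVec (fh d)) (fh d))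
    (Q : Matrix (Fin p) (Fin p) ℝ)
    (hQ : Q = ∑ d ∈ Finset.Icc 1 D, (fh d ⬝ᵥ fh d)⁻¹ • vecMulVec (fh d) (fh d)) :
    H D - J⁻¹ =
      ((-β) • (1 : Matrix (Fin p) (Fin p) ℝ) - J⁻¹) * (1 - Q) +
        ∑ d ∈ Finset.Icc 1 D,
          (fh d ⬝ᵥ fh d)⁻¹ • vecMulVec (sh d - J⁻¹.mulVec (fh d)) (fh d) := by
  have key : ∀ n, n ≤ D → H n = (-β) • (1 : Matrix (Fin p) (Fin p) ℝ) +
      ∑ d ∈ Finset.Icc 1 n, (fh d ⬝ᵥ fh d)⁻¹ • vecMulVec (sh d - (-β) • fh d) (fh d) := by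
    intro n
    induction n with
    | zero => intro _; simp [hH0]
    | succ n ih =>
      intro hn
      have ih' := ih (by omega)
      have hmul : (H n).mulVec (fh (n + 1)) = (-β) • fh (n + 1) := by
        rw [ih', Matrix.add_mulVec, Matrix.smul_mulVec, Matrix.one_mulVec, Matrix.sum_mulVec,
          Finset.sum_eq_zero, add_zero]
        intro d hd
        rw [Finset.mem_Icc] at hd
        have h0 : fh d ⬝ᵥ fh (n + 1) = 0 :=
          horth d (Finset.mem_Icc.2 ⟨hd.1, by omega⟩) (n + 1)
            (Finset.mem_Icc.2 ⟨by omega, hn⟩) (by omega)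
        rw [Matrix.smul_mulVec, Matrix.vecMulVec_mulVec, h0]
        simp
      rw [hH (n + 1) (by omega) hn, Nat.add_sub_cancel, hmul,
        Finset.sum_Icc_succ_top (by omega), ← add_assoc, ← ih']
  rw [key D le_rfl, mul_sub, mul_one, hQ, Finset.mul_sum, sub_add, ← Finset.sum_sub_distrib,
    add_sub_right_comm, sub_eq_add_neg (_ - J⁻¹), ← Finset.sum_neg_distrib]
  congr 1
  refine Finset.sum_congr rfl fun d _ => ?_
  rw [Matrix.mul_smul, Matrix.mul_vecMulVec, ← smul_sub, ← smul_neg, ← Matrix.sub_vecMulVec,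
    ← Matrix.neg_vecMulVec, Matrix.sub_mulVec, Matrix.smul_mulVec, Matrix.one_mulVec]
  congr 2
  abel
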